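/- Let F be a prime field of order p, 0 < α, β < n, and let μ be a probability measure on F^n satisfying (i) μ(x) ≤ C₁·p^{−α} for all x ∈ F^n, and (ii) |μ̂(ξ)| ≤ C₂·p^{−β/2} for all ξ ≠ 0. Then for every q ≥ (4n − 4α + 2β)/β and every f : F^n → ℂ, ‖(fμ)^∧‖_{L^q(F^n)} ≤ C·‖f‖_{L²(μ)}, where C depends only on n, α, β, C₁, C₂, q (not on p). Here (fμ)^∧(ξ) = Σ_x e(−x·ξ)f(x)μ(x), ‖g‖_{L^q(F^n)}^q = Σ_ξ |g(ξ)|^q, and ‖f‖²_{L²(μ)} = Σ_x |f(x)|² μ(x). -/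

import Mathlib

open Finset

noncomputable def e (p : ℕ) (t : ZMod p) : ℂ :=
  Complex.exp (2 * Real.pi * Complex.I * (t.val : ℂ) / (p : ℂ))

noncomputable def dft {p n : ℕ} [NeZero p] (f : (Fin n → ZMod p) → ℂ)
    (ξ : Fin n → ZMod p) : ℂ :=
  ∑ x : Fin n → ZMod p, e p (-(∑ i, x i * ξ i)) * f x

lemma e_eq_std (p : ℕ) [NeZero p] (t : ZMod p) : e p t = ZMod.stdAddChar t := by
  rw [ZMod.stdAddChar_apply, ZMod.toCircle_apply, e]

lemma e_add (p : ℕ) [NeZero p] (s t : ZMod p) : e p (s + t) = e p s * e p t := by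
  simp only [e_eq_std, AddChar.map_add_eq_mul]

lemma e_conj (p : ℕ) [NeZero p] (t : ZMod p) : (starRingEnd ℂ) (e p t) = e p (-t) := by
  rw [e_eq_std, e_eq_std, AddChar.map_neg_eq_conj]

lemma e_norm (p : ℕ) [NeZero p] (t : ZMod p) : ‖e p t‖ = 1 := by
  rw [e_eq_std, AddChar.norm_apply]

lemma e_zero (p : ℕ) [NeZero p] : e p 0 = 1 := by
  simp [e]

lemma e_sum (p : ℕ) [NeZero p] {ι : Type*} (s : Finset ι) (f : ι → ZMod p) :
    e p (∑ i ∈ s, f i) = ∏ i ∈ s, e p (f i) := by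
  classical
  induction s using Finset.induction_on with
  | empty => simp [e_zero]
  | insert a s ha ih => rw [Finset.sum_insert ha, Finset.prod_insert ha, e_add, ih]

lemma e_orth {p n : ℕ} [NeZero p] (z : Fin n → ZMod p) :
    ∑ ξ : Fin n → ZMod p, e p (∑ i, ξ i * z i) = if z = 0 then (p : ℂ) ^ n else 0 := by
  have h1 : ∀ i, ∑ t : ZMod p, e p (t * z i) = if z i = 0 then (p : ℂ) else 0 := by
    intro i
    simp only [e_eq_std]
    rw [AddChar.sum_mulShift (z i) (ZMod.isPrimitive_stdAddChar p)]
    simp [ZMod.card]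
  simp only [e_sum]
  have h2 := Finset.prod_univ_sum (fun _ : Fin n => (Finset.univ : Finset (ZMod p)))
    (fun i t => e p (t * z i))
  rw [Fintype.piFinset_univ] at h2
  rw [← h2]
  simp only [h1]
  split_ifs with h
  · subst h; simp
  · obtain ⟨i, hi⟩ := Function.ne_iff.mp h
    exact Finset.prod_eq_zero (Finset.mem_univ i) (if_neg hi)

/-- A weighted expansion of the square of a transform. -/
lemma dft_sq_expand {p n : ℕ} [NeZero p] (h : (Fin n → ZMod p) → ℂ)
    (m : (Fin n → ZMod p) → ℂ) :
    ∑ x, ((‖dft h x‖ ^ 2 : ℝ) : ℂ) * m x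
      = ∑ ξ, ∑ η, h ξ * (starRingEnd ℂ) (h η) * dft m (ξ - η) := by
  have h1 : ∀ x, ((‖dft h x‖ ^ 2 : ℝ) : ℂ) * m x =
      ∑ ξ, ∑ η, h ξ * (starRingEnd ℂ) (h η) * (e p (-(∑ i, x i * (ξ - η) i)) * m x) := by
    intro x
    push_cast
    rw [← Complex.mul_conj']
    unfold dft
    rw [map_sum, Finset.sum_mul_sum, Finset.sum_mul]
    refine Finset.sum_congr rfl fun ξ _ => ?_
    rw [Finset.sum_mul]
    refine Finset.sum_congr rfl fun η _ => ?_
    have : -(∑ i, x i * (ξ - η) i) = -(∑ i, ξ i * x i) + - -(∑ i, η i * x i) := by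
      simp only [Pi.sub_apply, mul_sub, Finset.sum_sub_distrib, mul_comm]
      ring
    rw [this, e_add, map_mul, e_conj]
    ring
  simp only [h1]
  rw [Finset.sum_comm]
  refine Finset.sum_congr rfl fun ξ _ => ?_
  rw [Finset.sum_comm]
  refine Finset.sum_congr rfl fun η _ => ?_
  rw [← Finset.mul_sum]
  rfl

lemma plancherel {p n : ℕ} [NeZero p] (h : (Fin n → ZMod p) → ℂ) :
    ∑ x, ‖dft h x‖ ^ 2 = (p : ℝ) ^ n * ∑ x, ‖h x‖ ^ 2 := by
  have h0 := dft_sq_expand h (fun _ => 1)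
  have h1 : ∀ z : Fin n → ZMod p, dft (fun _ => (1 : ℂ)) z = if z = 0 then (p : ℂ) ^ n else 0 := by
    intro z
    have := e_orth (-z)
    simp only [Pi.neg_apply, mul_neg, Finset.sum_neg_distrib, neg_eq_zero] at this
    simp only [dft, mul_one, this]
  simp only [h1, sub_eq_zero, mul_ite, mul_zero, Finset.sum_ite_eq, Finset.mem_univ, if_true,
    mul_one] at h0
  have h2 : ((∑ x, ‖dft h x‖ ^ 2 : ℝ) : ℂ) = (((p : ℝ) ^ n * ∑ x, ‖h x‖ ^ 2 : ℝ) : ℂ) := by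
    push_cast at h0 ⊢
    rw [h0, Finset.mul_sum]
    refine Finset.sum_congr rfl fun x _ => ?_
    rw [Complex.mul_conj']
    ring
  exact_mod_cast h2

lemma dft_symm {p n : ℕ} [NeZero p] (h F : (Fin n → ZMod p) → ℂ) :
    ∑ ξ, h ξ * dft F ξ = ∑ x, F x * dft h x := by
  unfold dft
  simp only [Finset.mul_sum]
  rw [Finset.sum_comm]
  refine Finset.sum_congr rfl fun x _ => Finset.sum_congr rfl fun ξ _ => ?_
  simp only [mul_comm (ξ _)]
  ring

/-- The `T T*` bound. -/
lemma dual_bound {p n : ℕ} [NeZero p] (μ : (Fin n → ZMod p) → ℝ) (D : ℝ)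
    (h0 : ∀ x, 0 ≤ μ x) (h1 : ∑ x, μ x = 1) (hD : 0 ≤ D)
    (hμ : ∀ ξ, ξ ≠ 0 → ‖dft (fun x => (μ x : ℂ)) ξ‖ ≤ D) (h : (Fin n → ZMod p) → ℂ) :
    ∑ x, ‖dft h x‖ ^ 2 * μ x ≤ ∑ ξ, ‖h ξ‖ ^ 2 + D * (∑ ξ, ‖h ξ‖) ^ 2 := by
  have hz : dft (fun x => (μ x : ℂ)) 0 = 1 := by
    simp only [dft, Pi.zero_apply, mul_zero, Finset.sum_const_zero, neg_zero, e_zero, one_mul]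
    exact_mod_cast h1
  have hall : ∀ ξ η : Fin n → ZMod p, ‖dft (fun x => (μ x : ℂ)) (ξ - η)‖
      ≤ (if ξ = η then 1 else 0) + D := by
    intro ξ η
    split_ifs with hh
    · subst hh; simp [hz, hD]
    · simpa using hμ _ (sub_ne_zero.mpr hh)
  have hx := dft_sq_expand h (fun x => (μ x : ℂ))
  have hr : ∑ x, ‖dft h x‖ ^ 2 * μ x = ‖∑ x, ((‖dft h x‖ ^ 2 : ℝ) : ℂ) * (μ x : ℂ)‖ := by
    have : ∑ x, ((‖dft h x‖ ^ 2 : ℝ) : ℂ) * (μ x : ℂ)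
        = ((∑ x, ‖dft h x‖ ^ 2 * μ x : ℝ) : ℂ) := by push_cast; rfl
    rw [this, Complex.norm_real, Real.norm_of_nonneg]
    exact Finset.sum_nonneg fun x _ => mul_nonneg (by positivity) (h0 x)
  rw [hr, hx]
  calc _ ≤ ∑ ξ, ∑ η, ‖h ξ * (starRingEnd ℂ) (h η) * dft (fun x => (μ x : ℂ)) (ξ - η)‖ :=
        (norm_sum_le _ _).trans (Finset.sum_le_sum fun ξ _ => norm_sum_le _ _)
    _ ≤ ∑ ξ, ∑ η, ‖h ξ‖ * ‖h η‖ * ((if ξ = η then 1 else 0) + D) := by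
        refine Finset.sum_le_sum fun ξ _ => Finset.sum_le_sum fun η _ => ?_
        rw [norm_mul, norm_mul, RCLike.norm_conj]
        exact mul_le_mul_of_nonneg_left (hall ξ η) (by positivity)
    _ = _ := by
        simp only [mul_add, Finset.sum_add_distrib, mul_ite, mul_one, mul_zero,
          Finset.sum_ite_eq, Finset.mem_univ, if_true]
        congr 1
        · exact Finset.sum_congr rfl fun ξ _ => (sq _).symm
        · rw [sq, Finset.sum_mul_sum, Finset.mul_sum]
          refine Finset.sum_congr rfl fun ξ _ => ?_
          rw [Finset.mul_sum]
          exact Finset.sum_congr rfl fun η _ => by ring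

lemma cs_weighted {ι : Type*} [Fintype ι] (μ : ι → ℝ) (h0 : ∀ x, 0 ≤ μ x) (f H : ι → ℂ) :
    ‖∑ x, f x * μ x * H x‖ ^ 2 ≤ (∑ x, ‖f x‖ ^ 2 * μ x) * ∑ x, ‖H x‖ ^ 2 * μ x := by
  have hn : ‖∑ x, f x * μ x * H x‖ ≤ ∑ x, (‖f x‖ * √(μ x)) * (‖H x‖ * √(μ x)) := by
    refine (norm_sum_le _ _).trans (Finset.sum_le_sum fun x _ => le_of_eq ?_)
    rw [norm_mul, norm_mul, Complex.norm_real, Real.norm_of_nonneg (h0 x)]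
    nth_rewrite 1 [← Real.mul_self_sqrt (h0 x)]
    ring
  calc _ ≤ (∑ x, (‖f x‖ * √(μ x)) * (‖H x‖ * √(μ x))) ^ 2 := by gcongr
    _ ≤ (∑ x, (‖f x‖ * √(μ x)) ^ 2) * ∑ x, (‖H x‖ * √(μ x)) ^ 2 :=
        Finset.sum_mul_sq_le_sq_mul_sq _ _ _
    _ = _ := by simp only [mul_pow, Real.sq_sqrt (h0 _)]

/-- Bound on the part of the sum where the transform is large. -/
lemma large_part {p n : ℕ} [NeZero p] (μ : (Fin n → ZMod p) → ℝ) (D q : ℝ) (hq : 2 ≤ q)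
    (h0 : ∀ x, 0 ≤ μ x) (h1 : ∑ x, μ x = 1) (hD : 0 ≤ D)
    (hμ : ∀ ξ, ξ ≠ 0 → ‖dft (fun x => (μ x : ℂ)) ξ‖ ≤ D) (f : (Fin n → ZMod p) → ℂ)
    (hf : ∑ x, ‖f x‖ ^ 2 * μ x ≤ 1) :
    ∑ ξ with 4 * D < ‖dft (fun x => f x * μ x) ξ‖ ^ 2, ‖dft (fun x => f x * μ x) ξ‖ ^ q
      ≤ 4 / 3 := by
  set g := dft (fun x => f x * μ x) with hg
  have hg1 : ∀ ξ, ‖g ξ‖ ≤ 1 := by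
    intro ξ
    have := cs_weighted μ h0 f (fun x => e p (-(∑ i, x i * ξ i)))
    simp only [e_norm, one_pow, one_mul, h1, mul_one] at this
    have h2 : g ξ = ∑ x, f x * μ x * e p (-(∑ i, x i * ξ i)) := by
      rw [hg, dft]; exact Finset.sum_congr rfl fun x _ => by ring
    rw [← h2] at this
    nlinarith [norm_nonneg (g ξ)]
  set X := ∑ ξ with 4 * D < ‖g ξ‖ ^ 2, ‖g ξ‖ ^ q with hX
  have hX0 : 0 ≤ X := Finset.sum_nonneg fun ξ _ => by positivity
  let h : (Fin n → ZMod p) → ℂ := fun ξ =>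
    if 4 * D < ‖g ξ‖ ^ 2 then (starRingEnd ℂ) (g ξ) * ((‖g ξ‖ ^ (q - 2) : ℝ) : ℂ) else 0
  have hpos : ∀ ξ, 4 * D < ‖g ξ‖ ^ 2 → 0 < ‖g ξ‖ := by
    intro ξ hh
    by_contra hc
    have : ‖g ξ‖ = 0 := le_antisymm (not_lt.mp hc) (norm_nonneg _)
    rw [this] at hh
    norm_num at hh
    linarith
  have hnorm : ∀ ξ, 4 * D < ‖g ξ‖ ^ 2 → ‖h ξ‖ * ‖g ξ‖ = ‖g ξ‖ ^ q := by
    intro ξ hh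
    have hp := hpos ξ hh
    simp only [h, if_pos hh, norm_mul, RCLike.norm_conj, Complex.norm_real]
    rw [Real.norm_of_nonneg (by positivity), Real.rpow_sub hp, Real.rpow_two]
    field_simp
  have hzero : ∀ ξ, ¬ 4 * D < ‖g ξ‖ ^ 2 → h ξ = 0 := fun ξ hh => if_neg hh
  have hle : ∀ ξ, 4 * D < ‖g ξ‖ ^ 2 → ‖h ξ‖ ≤ ‖g ξ‖ := by
    intro ξ hh
    simp only [h, if_pos hh, norm_mul, RCLike.norm_conj, Complex.norm_real]
    rw [Real.norm_of_nonneg (by positivity)]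
    exact mul_le_of_le_one_right (norm_nonneg _)
      (Real.rpow_le_one (norm_nonneg _) (hg1 ξ) (by linarith))
  have e1 : ∑ ξ, h ξ * g ξ = (X : ℂ) := by
    rw [hX, Finset.sum_filter]
    push_cast
    refine Finset.sum_congr rfl fun ξ _ => ?_
    by_cases hh : 4 * D < ‖g ξ‖ ^ 2
    · rw [if_pos hh, ]
      have hp := hpos ξ hh
      have : ‖g ξ‖ ^ q = ‖g ξ‖ ^ 2 * ‖g ξ‖ ^ (q - 2) := by
        rw [Real.rpow_sub hp, Real.rpow_two]; field_simp
      rw [this]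
      simp only [h, if_pos hh]
      push_cast
      rw [← Complex.mul_conj']
      ring
    · rw [if_neg hh, hzero ξ hh]; simp
  have e2 : ∑ ξ, ‖h ξ‖ ^ 2 ≤ X := by
    rw [hX, Finset.sum_filter]
    refine Finset.sum_le_sum fun ξ _ => ?_
    by_cases hh : 4 * D < ‖g ξ‖ ^ 2
    · rw [if_pos hh, ← hnorm ξ hh, sq]
      exact mul_le_mul_of_nonneg_left (hle ξ hh) (norm_nonneg _)
    · rw [if_neg hh, hzero ξ hh]; simp
  have e3 : 2 * √D * ∑ ξ, ‖h ξ‖ ≤ X := by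
    rw [hX, Finset.sum_filter, Finset.mul_sum]
    refine Finset.sum_le_sum fun ξ _ => ?_
    by_cases hh : 4 * D < ‖g ξ‖ ^ 2
    · rw [if_pos hh, ← hnorm ξ hh, mul_comm]
      refine mul_le_mul_of_nonneg_left ?_ (norm_nonneg _)
      refine le_of_sq_le_sq ?_ (norm_nonneg _)
      rw [mul_pow, Real.sq_sqrt hD]
      linarith
    · rw [if_neg hh, hzero ξ hh]; simp
  have e4 : X ^ 2 ≤ ∑ x, ‖dft h x‖ ^ 2 * μ x := by
    have c := cs_weighted μ h0 f (dft h)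
    rw [← dft_symm h (fun x => f x * μ x), ← hg, e1, Complex.norm_real,
      Real.norm_of_nonneg hX0] at c
    refine c.trans (mul_le_of_le_one_left ?_ hf)
    exact Finset.sum_nonneg fun x _ => mul_nonneg (by positivity) (h0 x)
  have e5 := dual_bound μ D h0 h1 hD hμ h
  have e6 : 4 * (D * (∑ ξ, ‖h ξ‖) ^ 2) ≤ X ^ 2 := by
    have := pow_le_pow_left₀ (by positivity) e3 2
    rw [mul_pow, mul_pow, Real.sq_sqrt hD] at this
    linarith
  nlinarith

lemma normalized_bound {p n : ℕ} [NeZero p] (μ : (Fin n → ZMod p) → ℝ) (D B q : ℝ) (hq : 2 ≤ q)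
    (h0 : ∀ x, 0 ≤ μ x) (h1 : ∑ x, μ x = 1) (hD : 0 ≤ D)
    (hB : ∀ x, μ x ≤ B)
    (hμ : ∀ ξ, ξ ≠ 0 → ‖dft (fun x => (μ x : ℂ)) ξ‖ ≤ D) (f : (Fin n → ZMod p) → ℂ)
    (hf : ∑ x, ‖f x‖ ^ 2 * μ x ≤ 1) :
    ∑ ξ, ‖dft (fun x => f x * μ x) ξ‖ ^ q
      ≤ 4 / 3 + (4 * D) ^ ((q - 2) / 2) * ((p : ℝ) ^ n * B) := by
  have hB0 : 0 ≤ B := (h0 0).trans (hB 0)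
  have hl := large_part μ D q hq h0 h1 hD hμ f hf
  have hP := plancherel (fun x => f x * μ x)
  set g := dft (fun x => f x * μ x) with hg
  rw [← Finset.sum_filter_add_sum_filter_not Finset.univ (fun ξ => 4 * D < ‖g ξ‖ ^ 2)]
  refine add_le_add hl ?_
  have hsum : ∑ ξ, ‖g ξ‖ ^ 2 ≤ (p : ℝ) ^ n * B := by
    rw [hP]
    refine mul_le_mul_of_nonneg_left ?_ (by positivity)
    calc ∑ x, ‖f x * μ x‖ ^ 2 ≤ ∑ x, B * (‖f x‖ ^ 2 * μ x) := by
          refine Finset.sum_le_sum fun x _ => ?_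
          rw [norm_mul, Complex.norm_real, Real.norm_of_nonneg (h0 x)]
          have := mul_le_mul_of_nonneg_right (hB x)
            (mul_nonneg (sq_nonneg ‖f x‖) (h0 x))
          linarith
      _ = B * ∑ x, ‖f x‖ ^ 2 * μ x := by rw [Finset.mul_sum]
      _ ≤ B := mul_le_of_le_one_right hB0 hf
  calc _ ≤ ∑ ξ with ¬ 4 * D < ‖g ξ‖ ^ 2, (4 * D) ^ ((q - 2) / 2) * ‖g ξ‖ ^ 2 := by
        refine Finset.sum_le_sum fun ξ hξ => ?_
        have hh : ‖g ξ‖ ^ 2 ≤ 4 * D := not_lt.mp (Finset.mem_filter.mp hξ).2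
        have hs : ‖g ξ‖ ^ q = (‖g ξ‖ ^ 2) ^ ((q - 2) / 2) * ‖g ξ‖ ^ 2 := by
          rw [← Real.rpow_two, ← Real.rpow_mul (norm_nonneg _),
            ← Real.rpow_add_of_nonneg (norm_nonneg _) (by linarith) (by norm_num)]
          congr 1; ring
        rw [hs]
        exact mul_le_mul_of_nonneg_right
          (Real.rpow_le_rpow (by positivity) hh (by linarith)) (by positivity)
    _ ≤ ∑ ξ, (4 * D) ^ ((q - 2) / 2) * ‖g ξ‖ ^ 2 :=
        Finset.sum_le_sum_of_subset_of_nonneg (Finset.filter_subset _ _)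
          fun _ _ _ => by positivity
    _ ≤ _ := by
        rw [← Finset.mul_sum]
        exact mul_le_mul_of_nonneg_left hsum (by positivity)

/-- Finite field Mockenhaupt–Mitsis–Bak–Seeger restriction theorem:
if `μ(x) ≤ C₁ p^{-α}` and `|μ̂(ξ)| ≤ C₂ p^{-β/2}` for `ξ ≠ 0`, then for every
`q ≥ (4n-4α+2β)/β` the extension estimate `‖(fμ)^∧‖_q ≤ C ‖f‖_{L²(μ)}` holds
with `C` independent of `p`. -/
theorem finite_field_restriction (n : ℕ) (α β C₁ C₂ q : ℝ)
    (hα0 : 0 < α) (hαn : α < n) (hβ0 : 0 < β) (hβn : β < n)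
    (hC₁ : 0 < C₁) (hC₂ : 0 < C₂)
    (hq : (4 * n - 4 * α + 2 * β) / β ≤ q) :
    ∃ C : ℝ, 0 < C ∧
      ∀ (p : ℕ) [Fact p.Prime] (μ : (Fin n → ZMod p) → ℝ),
        (∀ x, 0 ≤ μ x) → (∑ x, μ x) = 1 →
        (∀ x, μ x ≤ C₁ * (p : ℝ) ^ (-α)) →
        (∀ ξ, ξ ≠ 0 → ‖dft (fun x => (μ x : ℂ)) ξ‖ ≤ C₂ * (p : ℝ) ^ (-β / 2)) →
        ∀ f : (Fin n → ZMod p) → ℂ,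
          (∑ ξ : Fin n → ZMod p, ‖dft (fun x => f x * μ x) ξ‖ ^ q) ^ (1 / q)
            ≤ C * (∑ x : Fin n → ZMod p, ‖f x‖ ^ 2 * μ x) ^ ((1 : ℝ) / 2) := by
  have hq2 : 2 < q := by
    refine lt_of_lt_of_le ?_ hq
    rw [lt_div_iff₀ hβ0]; linarith
  have hq' : 4 * n - 4 * α + 2 * β ≤ q * β := (div_le_iff₀ hβ0).mp hq
  have hq0 : 0 < q := by linarith
  set K : ℝ := 4 / 3 + (4 * C₂) ^ ((q - 2) / 2) * C₁ with hK
  have hK0 : 0 < K := by positivity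
  refine ⟨K ^ (1 / q), by positivity, ?_⟩
  intro p _ μ h0 h1 hB hμ f
  have hp1 : (1 : ℝ) ≤ p := by exact_mod_cast (Fact.out : p.Prime).one_lt.le
  have hp0 : (0 : ℝ) < p := by linarith
  have key : ∀ f : (Fin n → ZMod p) → ℂ, ∑ x, ‖f x‖ ^ 2 * μ x ≤ 1 →
      ∑ ξ, ‖dft (fun x => f x * μ x) ξ‖ ^ q ≤ K := by
    intro f hf
    refine (normalized_bound μ _ _ q hq2.le h0 h1 (by positivity) hB hμ f hf).trans ?_
    rw [hK]
    refine add_le_add le_rfl ?_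
    rw [← mul_assoc, ← mul_assoc 4 C₂, Real.mul_rpow (by positivity) (by positivity), ← Real.rpow_mul hp0.le,
      ← Real.rpow_natCast]
    have : (p : ℝ) ^ (-β / 2 * ((q - 2) / 2)) * (p : ℝ) ^ (n : ℝ) * (p : ℝ) ^ (-α) ≤ 1 := by
      rw [← Real.rpow_add hp0, ← Real.rpow_add hp0]
      exact Real.rpow_le_one_of_one_le_of_nonpos hp1 (by nlinarith)
    have h2 : 0 ≤ (4 * C₂) ^ ((q - 2) / 2) * C₁ := by positivity
    have := mul_le_mul_of_nonneg_left this h2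
    linarith
  set N := ∑ x, ‖f x‖ ^ 2 * μ x with hN
  have hN0 : 0 ≤ N := Finset.sum_nonneg fun x _ => mul_nonneg (by positivity) (h0 x)
  rcases hN0.eq_or_lt with hz | hpos
  · have hfx : ∀ x, f x * (μ x : ℂ) = 0 := by
      intro x
      have := (Finset.sum_eq_zero_iff_of_nonneg
        (fun x _ => mul_nonneg (sq_nonneg ‖f x‖) (h0 x))).mp hz.symm x (Finset.mem_univ x)
      rcases mul_eq_zero.mp this with h | h
      · rw [norm_eq_zero.mp (pow_eq_zero_iff (two_ne_zero) |>.mp h), zero_mul]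
      · rw [h]; simp
    have : ∀ ξ, dft (fun x => f x * (μ x : ℂ)) ξ = 0 := by
      intro ξ; simp [dft, hfx]
    simp only [this, norm_zero, Real.zero_rpow hq0.ne', Finset.sum_const_zero]
    rw [Real.zero_rpow (by positivity)]
    positivity
  · have hs : 0 < √N := Real.sqrt_pos.mpr hpos
    have k := key (fun x => ((√N)⁻¹ : ℝ) * f x) (by
      simp only [norm_mul, Complex.norm_real, mul_pow, mul_assoc]
      rw [← Finset.mul_sum, ← hN, Real.norm_of_nonneg (by positivity), inv_pow,
        Real.sq_sqrt hN0, inv_mul_cancel₀ hpos.ne'])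
    have hd : ∀ ξ, ‖dft (fun x => (((√N)⁻¹ : ℝ) * f x) * (μ x : ℂ)) ξ‖ ^ q
        = ((√N) ^ q)⁻¹ * ‖dft (fun x => f x * (μ x : ℂ)) ξ‖ ^ q := by
      intro ξ
      have : dft (fun x => (((√N)⁻¹ : ℝ) * f x) * (μ x : ℂ)) ξ
          = ((√N)⁻¹ : ℝ) * dft (fun x => f x * (μ x : ℂ)) ξ := by
        simp only [dft, Finset.mul_sum]
        exact Finset.sum_congr rfl fun x _ => by ring
      rw [this, norm_mul, Complex.norm_real, Real.norm_of_nonneg (by positivity),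
        Real.mul_rpow (by positivity) (norm_nonneg _), Real.inv_rpow hs.le]
    simp only [hd] at k
    rw [← Finset.mul_sum, inv_mul_le_iff₀ (by positivity)] at k
    have k2 := Real.rpow_le_rpow (Finset.sum_nonneg fun ξ _ => by positivity) k
      (by positivity : 0 ≤ 1 / q)
    refine k2.trans (le_of_eq ?_)
    rw [Real.mul_rpow (by positivity) hK0.le, ← Real.rpow_mul hs.le,
      mul_one_div_cancel hq0.ne', Real.rpow_one, Real.sqrt_eq_rpow, mul_comm]
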